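/- arXiv:1406.7457 — 4 statements merged into one kernel-verified Lean document; each statement's English description precedes it below -/
import Mathlib

section
/- Let p : ℝ² → ℝ be a polynomial function. If ∫_K λ₀(x) λ₂(x) p(x)² dx = 0, then p = 0 identically on ℝ². -/
open MeasureTheory

noncomputable section

/-- For a column vector `v ∈ ℝ²`, `vvT v` is the rank-one symmetric matrix `v vᵀ`. -/
def vvT (v : Fin 2 → ℝ) : Matrix (Fin 2) (Fin 2) ℝ :=
  Matrix.of fun i j => v i * v j

/-- For `n = (a, b)`, `perp n = (−b, a)`. -/
def perp (n : Fin 2 → ℝ) : Fin 2 → ℝ := ![-(n 1), n 0]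

/-- Frobenius inner product `A : B` of 2×2 matrices. -/
def frob (A B : Matrix (Fin 2) (Fin 2) ℝ) : ℝ :=
  ∑ i : Fin 2, ∑ j : Fin 2, A i j * B i j

/-- Partial derivative in the `i`-th coordinate direction. -/
def pd (i : Fin 2) (f : (Fin 2 → ℝ) → ℝ) : (Fin 2 → ℝ) → ℝ :=
  fun x => fderiv ℝ f x (Pi.single i 1)

/-- Row-wise divergence of a matrix field: `(div τ)_i = ∂τ_{i1}/∂x + ∂τ_{i2}/∂y`. -/
def matDiv (τ : (Fin 2 → ℝ) → Matrix (Fin 2) (Fin 2) ℝ) : (Fin 2 → ℝ) → Fin 2 → ℝ :=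
  fun x i => pd 0 (fun y => τ y i 0) x + pd 1 (fun y => τ y i 1) x

/-- Symmetric gradient `ε(v) = (Dv + (Dv)ᵀ)/2` of a vector field. -/
def symGrad (v : (Fin 2 → ℝ) → Fin 2 → ℝ) : (Fin 2 → ℝ) → Matrix (Fin 2) (Fin 2) ℝ :=
  fun x => Matrix.of fun i j => (pd j (fun y => v y i) x + pd i (fun y => v y j) x) / 2

/-- A rigid motion `(x, y) ↦ (a − by, c + bx)`. -/
def IsRigidMotion (r : (Fin 2 → ℝ) → Fin 2 → ℝ) : Prop :=
  ∃ a b c : ℝ, ∀ x, r x = ![a - b * x 1, c + b * x 0]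

/-- `f : ℝ² → ℝ` is a polynomial function of total degree at most `m`
(the zero space when `m < 0`). -/
def IsPolyDeg (m : ℤ) (f : (Fin 2 → ℝ) → ℝ) : Prop :=
  ∃ p : MvPolynomial (Fin 2) ℝ, (∀ x, f x = MvPolynomial.eval x p) ∧
    ((p.totalDegree : ℤ) ≤ m ∨ p = 0)

/-- `f : ℝ² → ℝ` is an affine function. -/
def IsAffineFn (f : (Fin 2 → ℝ) → ℝ) : Prop :=
  ∃ (w : Fin 2 → ℝ) (c : ℝ), ∀ x, f x = w 0 * x 0 + w 1 * x 1 + c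

/-- The triangle `K` with the given vertices. -/
def Ktri (x0 x1 x2 : Fin 2 → ℝ) : Set (Fin 2 → ℝ) :=
  convexHull ℝ {x0, x1, x2}

/-- The matrix whose columns are `x1 − x0` and `x2 − x0`. -/
def Bmat (x0 x1 x2 : Fin 2 → ℝ) : Matrix (Fin 2) (Fin 2) ℝ :=
  Matrix.of fun i j => if j = 0 then x1 i - x0 i else x2 i - x0 i

/-- `nvec x0 x1 x2 1` and `nvec x0 x1 x2 2` are the rows of `(Bmat x0 x1 x2)⁻¹`,
and `nvec x0 x1 x2 0 = −n₁ − n₂`. -/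
def nvec (x0 x1 x2 : Fin 2 → ℝ) : Fin 3 → Fin 2 → ℝ :=
  ![fun j => -((Bmat x0 x1 x2)⁻¹ 0 j) - (Bmat x0 x1 x2)⁻¹ 1 j,
    fun j => (Bmat x0 x1 x2)⁻¹ 0 j,
    fun j => (Bmat x0 x1 x2)⁻¹ 1 j]

/-- The bubble stress `λ₂λ₀ p₁ n₁⊥(n₁⊥)ᵀ + λ₀λ₁ p₂ n₂⊥(n₂⊥)ᵀ + λ₁λ₂ p₀ n₀⊥(n₀⊥)ᵀ`. -/
def bubbleStress (x0 x1 x2 : Fin 2 → ℝ) (lam : Fin 3 → (Fin 2 → ℝ) → ℝ)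
    (p : Fin 3 → (Fin 2 → ℝ) → ℝ) : (Fin 2 → ℝ) → Matrix (Fin 2) (Fin 2) ℝ :=
  fun x => (lam 2 x * lam 0 x * p 1 x) • vvT (perp (nvec x0 x1 x2 1))
         + (lam 0 x * lam 1 x * p 2 x) • vvT (perp (nvec x0 x1 x2 2))
         + (lam 1 x * lam 2 x * p 0 x) • vvT (perp (nvec x0 x1 x2 0))

/-- Membership in the local bubble stress space `Σ_{K,b}` of order `k`. -/
def SigmaKb (k : ℕ) (x0 x1 x2 : Fin 2 → ℝ) (lam : Fin 3 → (Fin 2 → ℝ) → ℝ)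
    (τ : (Fin 2 → ℝ) → Matrix (Fin 2) (Fin 2) ℝ) : Prop :=
  ∃ p : Fin 3 → (Fin 2 → ℝ) → ℝ,
    (∀ i, IsPolyDeg ((k : ℤ) - 2) (p i)) ∧ τ = bubbleStress x0 x1 x2 lam p

/-- A polynomial in finitely many variables that vanishes on a nonempty open set is zero. -/
theorem MvPolynomial.eq_zero_of_eval_eq_zero_on_isOpen {ι : Type*} [Finite ι]
    {P : MvPolynomial ι ℝ} {U : Set (ι → ℝ)} (hU : IsOpen U) (hne : U.Nonempty)
    (h : ∀ x ∈ U, MvPolynomial.eval x P = 0) : P = 0 := by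
  have := Fintype.ofFinite ι
  obtain ⟨a, ha⟩ := hne
  obtain ⟨ε, hε, hball⟩ := Metric.isOpen_iff.1 hU a ha
  refine MvPolynomial.funext_set (fun i => Metric.ball (a i) ε) (fun i => ?_) fun x hx => ?_
  · rw [Real.ball_eq_Ioo]
    exact Set.Ioo_infinite (by linarith)
  · rw [map_zero]
    exact h x (hball (by rwa [ball_pi a hε]))

/-- An affine function on the plane is given by a polynomial. -/
theorem IsAffineFn.exists_mvPolynomial {f : (Fin 2 → ℝ) → ℝ} (hf : IsAffineFn f) :
    ∃ P : MvPolynomial (Fin 2) ℝ, ∀ x, f x = MvPolynomial.eval x P := by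
  obtain ⟨w, c, h⟩ := hf
  refine ⟨.C (w 0) * .X 0 + .C (w 1) * .X 1 + .C c, fun x => ?_⟩
  simp [h]

/-- An affine function that is nonnegative on a set is nonnegative on its convex hull. -/
theorem IsAffineFn.nonneg_of_mem_convexHull {f : (Fin 2 → ℝ) → ℝ} (hf : IsAffineFn f)
    {s : Set (Fin 2 → ℝ)} (hs : ∀ x ∈ s, 0 ≤ f x) {x : Fin 2 → ℝ} (hx : x ∈ convexHull ℝ s) :
    0 ≤ f x := by
  obtain ⟨w, c, h⟩ := hf
  refine convexHull_min (t := {x | 0 ≤ f x}) hs (fun x hx y hy a b ha hb hab => ?_) hx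
  simp only [Set.mem_ofPred_eq] at hx hy ⊢
  have key : f (a • x + b • y) = a * f x + b * f y := by
    simp only [h, Pi.add_apply, Pi.smul_apply, smul_eq_mul]
    linear_combination (-c) * hab
  rw [key]
  positivity

/-- A nondegenerate triangle has nonempty interior. -/
theorem interior_Ktri_nonempty {x0 x1 x2 : Fin 2 → ℝ}
    (h : AffineIndependent ℝ ![x0, x1, x2]) : (interior (Ktri x0 x1 x2)).Nonempty := by
  have hspan : affineSpan ℝ (Set.range ![x0, x1, x2]) = ⊤ :=
    h.affineSpan_eq_top_iff_card_eq_finrank_add_one.2 (by simp)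
  rw [Ktri, interior_convexHull_nonempty_iff_affineSpan_eq_top, ← hspan]
  congr 1
  ext
  simp [Matrix.range_cons]
  tauto

theorem stmt_5 (x0 x1 x2 : Fin 2 → ℝ)
    (hind : AffineIndependent ℝ ![x0, x1, x2])
    (lam : Fin 3 → (Fin 2 → ℝ) → ℝ)
    (hlam_aff : ∀ i, IsAffineFn (lam i))
    (hlam_val : ∀ i j : Fin 3, lam i (![x0, x1, x2] j) = if i = j then 1 else 0)
    (p : (Fin 2 → ℝ) → ℝ)
    (hp : ∃ q : MvPolynomial (Fin 2) ℝ, ∀ x, p x = MvPolynomial.eval x q)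
    (hint : ∫ x in Ktri x0 x1 x2, lam 0 x * lam 2 x * p x ^ 2 = 0) :
    ∀ x, p x = 0 := by
  obtain ⟨q, hq⟩ := hp
  choose L hL using fun i => (hlam_aff i).exists_mvPolynomial
  set F : MvPolynomial (Fin 2) ℝ := L 0 * L 2 * q ^ 2 with hF
  have hFeval : ∀ x, lam 0 x * lam 2 x * p x ^ 2 = MvPolynomial.eval x F := fun x => by
    simp [hF, hL, hq]
  have hcont : Continuous fun x => MvPolynomial.eval x F := MvPolynomial.continuous_eval F
  have hcompact : IsCompact (Ktri x0 x1 x2) :=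
    Set.Finite.isCompact_convexHull ℝ (Set.toFinite {x0, x1, x2})
  have hlam_nonneg : ∀ i, ∀ x ∈ Ktri x0 x1 x2, 0 ≤ lam i x := fun i x hx => by
    refine (hlam_aff i).nonneg_of_mem_convexHull (fun y hy => ?_) hx
    obtain ⟨j, rfl⟩ : ∃ j, ![x0, x1, x2] j = y := by
      rcases hy with rfl | rfl | rfl
      exacts [⟨0, rfl⟩, ⟨1, rfl⟩, ⟨2, rfl⟩]
    rw [hlam_val]
    split_ifs <;> norm_num
  have hnonneg : ∀ x ∈ Ktri x0 x1 x2, 0 ≤ MvPolynomial.eval x F := fun x hx => by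
    rw [← hFeval]
    exact mul_nonneg (mul_nonneg (hlam_nonneg 0 x hx) (hlam_nonneg 2 x hx)) (sq_nonneg _)
  simp only [hFeval] at hint
  have hae := (setIntegral_eq_zero_iff_of_nonneg_ae
    (ae_restrict_of_forall_mem hcompact.measurableSet hnonneg)
    (hcont.continuousOn.integrableOn_compact hcompact)).1 hint
  have hzero : ∀ x ∈ interior (Ktri x0 x1 x2), MvPolynomial.eval x F = 0 :=
    Measure.eqOn_open_of_ae_eq (ae_restrict_of_ae_restrict_of_subset interior_subset hae)
      isOpen_interior hcont.continuousOn continuousOn_const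
  have hF0 : F = 0 := MvPolynomial.eq_zero_of_eval_eq_zero_on_isOpen isOpen_interior
    (interior_Ktri_nonempty hind) hzero
  have hL_ne : ∀ i, L i ≠ 0 := fun i hi => by
    have := hlam_val i i
    simp [hL, hi] at this
  have hq0 : q = 0 := by simpa [hF, hL_ne] using hF0
  intro x
  rw [hq, hq0, map_zero]
end
end

section
/- Let k ≥ 2 be an integer. If p₀, p₁, p₂ ∈ P_{k−2} satisfy λ₂λ₀ p₁ n₁⊥(n₁⊥)ᵀ + λ₀λ₁ p₂ n₂⊥(n₂⊥)ᵀ + λ₁λ₂ p₀ n₀⊥(n₀⊥)ᵀ = 0 identically on ℝ², then p₀ = p₁ = p₂ = 0. Consequently, the space Σ_{K,b} has dimension 3·dim P_{k−2} = (3/2)k² − (3/2)k. -/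
open MeasureTheory

noncomputable section

/-- The number of bivariate monomials of total degree at most `m`, doubled. -/
theorem two_mul_card_sum_le (m : ℕ) :
    2 * Nat.card {s : Fin 2 →₀ ℕ | (s.sum fun _ e => e) ≤ m} = (m + 1) * (m + 2) := by
  have e : {s : Fin 2 →₀ ℕ | (s.sum fun _ e => e) ≤ m} ≃
      (Finset.range (m + 1)).sigma fun i => Finset.HasAntidiagonal.antidiagonal i :=
    { toFun := fun s => ⟨⟨s.1 0 + s.1 1, s.1 0, s.1 1⟩, by
        have h := s.2
        rw [Set.mem_ofPred_eq, Finsupp.sum_fintype _ _ fun _ => rfl, Fin.sum_univ_two] at h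
        simp; omega⟩
      invFun := fun t => ⟨Finsupp.equivFunOnFinite.symm ![t.1.2.1, t.1.2.2], by
        have h := t.2
        simp only [Finset.mem_sigma, Finset.mem_range, Finset.HasAntidiagonal.mem_antidiagonal] at h
        rw [Set.mem_ofPred_eq, Finsupp.sum_fintype _ _ fun _ => rfl, Fin.sum_univ_two]
        simp; omega⟩
      left_inv := fun s => by
        ext i
        fin_cases i <;> simp
      right_inv := fun t => by
        obtain ⟨⟨n, i, j⟩, h⟩ := t
        simp only [Finset.mem_sigma, Finset.mem_range, Finset.HasAntidiagonal.mem_antidiagonal] at h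
        obtain ⟨_, rfl⟩ := h
        simp }
  rw [Nat.card_congr e, Nat.card_eq_fintype_card, Fintype.card_coe, Finset.card_sigma]
  simp only [Finset.Nat.card_antidiagonal]
  have h := Finset.sum_range_id_mul_two (m + 2)
  rw [Finset.sum_range_succ'] at h
  simp only [add_zero, show m + 2 - 1 = m + 1 by omega] at h
  linarith

theorem two_mul_finrank_restrictTotalDegree (m : ℕ) :
    2 * Module.finrank ℝ (MvPolynomial.restrictTotalDegree (Fin 2) ℝ m) =
      (m + 1) * (m + 2) := by
  rw [← two_mul_card_sum_le]
  congr 1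
  exact Module.finrank_eq_nat_card_basis (MvPolynomial.basisRestrictSupport ℝ _)

theorem isPolyDeg_natCast_iff (m : ℕ) (f : (Fin 2 → ℝ) → ℝ) :
    IsPolyDeg m f ↔ ∃ p ∈ MvPolynomial.restrictTotalDegree (Fin 2) ℝ m,
      ∀ x, f x = MvPolynomial.eval x p := by
  constructor
  · rintro ⟨p, hf, h⟩
    refine ⟨p, ?_, hf⟩
    rcases h with h | rfl
    · exact (MvPolynomial.mem_restrictTotalDegree _ _ _).2 (by exact_mod_cast h)
    · exact zero_mem _
  · rintro ⟨p, hp, hf⟩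
    exact ⟨p, hf, Or.inl (by exact_mod_cast (MvPolynomial.mem_restrictTotalDegree _ _ _).1 hp)⟩

theorem IsAffineFn.exists_eval {f : (Fin 2 → ℝ) → ℝ} (hf : IsAffineFn f) :
    ∃ p : MvPolynomial (Fin 2) ℝ, ∀ x, f x = MvPolynomial.eval x p := by
  obtain ⟨w, c, h⟩ := hf
  exact ⟨.C (w 0) * .X 0 + .C (w 1) * .X 1 + .C c, fun x => by simp [h]⟩

/-- The edge-difference matrix of a triangle admitting barycentric coordinates is invertible. -/
theorem det_Bmat_inv_ne_zero {x0 x1 x2 : Fin 2 → ℝ} {lam : Fin 3 → (Fin 2 → ℝ) → ℝ}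
    (hlam_aff : ∀ i, IsAffineFn (lam i))
    (hlam_val : ∀ i j : Fin 3, lam i (![x0, x1, x2] j) = if i = j then 1 else 0) :
    (Bmat x0 x1 x2)⁻¹.det ≠ 0 := by
  obtain ⟨w, c, hw⟩ := hlam_aff 1
  obtain ⟨v, d, hv⟩ := hlam_aff 2
  have h : !![w 0, w 1; v 0, v 1] * Bmat x0 x1 x2 = 1 := by
    have h10 := hlam_val 1 0
    have h11 := hlam_val 1 1
    have h12 := hlam_val 1 2
    have h20 := hlam_val 2 0
    have h21 := hlam_val 2 1
    have h22 := hlam_val 2 2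
    simp [hw, hv] at h10 h11 h12 h20 h21 h22
    ext i j
    fin_cases i <;> fin_cases j <;>
      simp [Bmat, Matrix.mul_apply, Fin.sum_univ_two] <;> linarith
  have h2 := congrArg Matrix.det h
  rw [Matrix.det_mul, Matrix.det_one] at h2
  rw [Matrix.det_nonsing_inv, Ring.inverse_eq_inv']
  exact inv_ne_zero (right_ne_zero_of_mul_eq_one h2)

/-- The matrices `nᵢ⊥(nᵢ⊥)ᵀ` are linearly independent. -/
theorem coeff_eq_zero_of_sum_vvT_eq_zero {x0 x1 x2 : Fin 2 → ℝ}
    (hdet : (Bmat x0 x1 x2)⁻¹.det ≠ 0) {r s t : ℝ}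
    (h : r • vvT (perp (nvec x0 x1 x2 1)) + s • vvT (perp (nvec x0 x1 x2 2))
      + t • vvT (perp (nvec x0 x1 x2 0)) = 0) : r = 0 ∧ s = 0 ∧ t = 0 := by
  have h00 := congrFun (congrFun h 0) 0
  have h01 := congrFun (congrFun h 0) 1
  have h11 := congrFun (congrFun h 1) 1
  rw [Matrix.det_fin_two] at hdet
  simp [vvT, perp, nvec] at h00 h01 h11
  generalize (Bmat x0 x1 x2)⁻¹ 0 0 = a at *
  generalize (Bmat x0 x1 x2)⁻¹ 0 1 = b at *
  generalize (Bmat x0 x1 x2)⁻¹ 1 0 = c at *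
  generalize (Bmat x0 x1 x2)⁻¹ 1 1 = d at *
  have hD : (a * d - b * c) ^ 2 ≠ 0 := pow_ne_zero 2 hdet
  have h1 : s + t = 0 := mul_right_cancel₀ hD (by
    linear_combination a ^ 2 * h00 + 2 * a * b * h01 + b ^ 2 * h11)
  have h2 : r + t = 0 := mul_right_cancel₀ hD (by
    linear_combination c ^ 2 * h00 + 2 * c * d * h01 + d ^ 2 * h11)
  have h3 : r + s = 0 := mul_right_cancel₀ hD (by
    linear_combination (a + c) ^ 2 * h00 + 2 * (a + c) * (b + d) * h01 + (b + d) ^ 2 * h11)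
  exact ⟨by linarith, by linarith, by linarith⟩

theorem eq_zero_of_bubbleStress_eval_eq_zero {x0 x1 x2 : Fin 2 → ℝ}
    {lam : Fin 3 → (Fin 2 → ℝ) → ℝ} (hlam_aff : ∀ i, IsAffineFn (lam i))
    (hlam_val : ∀ i j : Fin 3, lam i (![x0, x1, x2] j) = if i = j then 1 else 0)
    (q : Fin 3 → MvPolynomial (Fin 2) ℝ)
    (h : ∀ x, bubbleStress x0 x1 x2 lam (fun i x => MvPolynomial.eval x (q i)) x = 0) :
    q = 0 := by
  choose L hL using fun i => (hlam_aff i).exists_eval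
  have hL0 : ∀ i, L i ≠ 0 := fun i hi => by
    have h1 := hlam_val i i
    rw [hL, hi] at h1
    simp at h1
  have cancel : ∀ i j l, (∀ x, lam i x * lam j x * MvPolynomial.eval x (q l) = 0) → q l = 0 := by
    intro i j l hx
    have h0 : L i * L j * q l = 0 := MvPolynomial.funext fun x => by simpa [hL] using hx x
    simpa [hL0] using h0
  have key := fun x => coeff_eq_zero_of_sum_vvT_eq_zero
    (det_Bmat_inv_ne_zero hlam_aff hlam_val) (h x)
  funext i
  fin_cases i
  · exact cancel 1 2 0 fun x => (key x).2.2
  · exact cancel 2 0 1 fun x => (key x).1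
  · exact cancel 0 1 2 fun x => (key x).2.1

/-- The parametrization of the bubble stress space by triples of polynomials. -/
def bubbleStressLinearMap (m : ℕ) (x0 x1 x2 : Fin 2 → ℝ) (lam : Fin 3 → (Fin 2 → ℝ) → ℝ) :
    (Fin 3 → MvPolynomial.restrictTotalDegree (Fin 2) ℝ m) →ₗ[ℝ]
      ((Fin 2 → ℝ) → Matrix (Fin 2) (Fin 2) ℝ) where
  toFun q := bubbleStress x0 x1 x2 lam fun i x => MvPolynomial.eval x (q i).1
  map_add' p q := by
    funext x
    simp only [bubbleStress, Pi.add_apply, Submodule.coe_add, map_add]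
    module
  map_smul' c q := by
    funext x
    simp only [bubbleStress, Pi.smul_apply, Submodule.coe_smul, MvPolynomial.smul_eval,
      RingHom.id_apply]
    module

theorem coe_range_bubbleStressLinearMap (m : ℕ) (x0 x1 x2 : Fin 2 → ℝ)
    (lam : Fin 3 → (Fin 2 → ℝ) → ℝ) :
    (LinearMap.range (bubbleStressLinearMap m x0 x1 x2 lam) : Set _) =
      {τ | SigmaKb (m + 2) x0 x1 x2 lam τ} := by
  have hm : ((m + 2 : ℕ) : ℤ) - 2 = m := by push_cast; ring
  ext τ
  simp only [SetLike.mem_coe, LinearMap.mem_range, Set.mem_ofPred_eq, SigmaKb, hm,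
    isPolyDeg_natCast_iff]
  constructor
  · rintro ⟨q, rfl⟩
    exact ⟨_, fun i => ⟨(q i).1, (q i).2, fun _ => rfl⟩, rfl⟩
  · rintro ⟨p, hp, rfl⟩
    choose q hq hpq using hp
    obtain rfl : p = fun i x => MvPolynomial.eval x (q i) := by
      funext i x
      exact hpq i x
    exact ⟨fun i => ⟨q i, hq i⟩, rfl⟩

theorem stmt_6 (k : ℕ) (hk : 2 ≤ k)
    (x0 x1 x2 : Fin 2 → ℝ)
    (hind : AffineIndependent ℝ ![x0, x1, x2])
    (lam : Fin 3 → (Fin 2 → ℝ) → ℝ)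
    (hlam_aff : ∀ i, IsAffineFn (lam i))
    (hlam_val : ∀ i j : Fin 3, lam i (![x0, x1, x2] j) = if i = j then 1 else 0) :
    (∀ p : Fin 3 → (Fin 2 → ℝ) → ℝ, (∀ i, IsPolyDeg ((k : ℤ) - 2) (p i)) →
      (∀ x, bubbleStress x0 x1 x2 lam p x = 0) → ∀ i x, p i x = 0) ∧
    Module.finrank ℝ (Submodule.span ℝ {τ | SigmaKb k x0 x1 x2 lam τ}) =
      (3 * k ^ 2 - 3 * k) / 2 := by
  refine ⟨fun p hp h => ?_, ?_⟩
  · choose q hpq _ using hp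
    obtain rfl : p = fun i x => MvPolynomial.eval x (q i) := by
      funext i x
      exact hpq i x
    have hq := eq_zero_of_bubbleStress_eval_eq_zero hlam_aff hlam_val q h
    intro i x
    simp [hq]
  · obtain ⟨m, rfl⟩ := Nat.exists_eq_add_of_le' hk
    have hinj : Function.Injective (bubbleStressLinearMap m x0 x1 x2 lam) := by
      rw [injective_iff_map_eq_zero]
      intro q hq
      have h0 := eq_zero_of_bubbleStress_eval_eq_zero hlam_aff hlam_val (fun i => (q i).1)
        (congrFun hq)
      funext i
      exact Subtype.ext (congrFun h0 i)
    rw [← coe_range_bubbleStressLinearMap, Submodule.span_eq, LinearMap.finrank_range_of_inj hinj,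
      Module.finrank_pi_fintype]
    simp only [Finset.sum_const, Finset.card_univ, Fintype.card_fin, smul_eq_mul]
    have h2 := two_mul_finrank_restrictTotalDegree m
    have h3 : 3 * (m + 2) ^ 2 = 3 * ((m + 1) * (m + 2)) + 3 * (m + 2) := by ring
    omega
end
end

section
/- Let k ≥ 2 be an integer and let v be a P_{k−1} vector field. If ∫_K τ(x) : ε(v)(x) dx = 0 for every τ ∈ Σ_{K,b}, then ε(v) = 0 identically on ℝ². -/
open MeasureTheory

noncomputable section

theorem MvPolynomial.totalDegree_pderiv_succ_le {σ R : Type*} [CommSemiring R]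
    (i : σ) (p : MvPolynomial σ R) (h : MvPolynomial.pderiv i p ≠ 0) :
    (MvPolynomial.pderiv i p).totalDegree + 1 ≤ p.totalDegree := by
  obtain ⟨s, hs, hdeg⟩ := Finset.exists_mem_eq_sup _ (MvPolynomial.support_nonempty.2 h)
    (fun s : σ →₀ ℕ => s.sum fun _ e => e)
  have hp : s + Finsupp.single i 1 ∈ p.support := by
    rw [MvPolynomial.mem_support_iff] at hs ⊢
    rw [MvPolynomial.coeff_pderiv] at hs
    exact left_ne_zero_of_mul hs
  have hle := MvPolynomial.le_totalDegree hp
  rw [Finsupp.sum_add_index' (fun _ => rfl) (fun _ _ _ => rfl),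
    Finsupp.sum_single_index rfl] at hle
  rw [MvPolynomial.totalDegree, hdeg]
  exact hle

theorem MvPolynomial.fderiv_eval_single {σ : Type*} [Fintype σ] [DecidableEq σ]
    (p : MvPolynomial σ ℝ) (i : σ) (x : σ → ℝ) :
    fderiv ℝ (fun y => MvPolynomial.eval y p) x (Pi.single i 1) =
      MvPolynomial.eval x (MvPolynomial.pderiv i p) := by
  have hdiff : ∀ q : MvPolynomial σ ℝ,
      DifferentiableAt ℝ (fun y : σ → ℝ => MvPolynomial.eval y q) x := fun q =>
    (AnalyticOnNhd.eval_mvPolynomial q x (Set.mem_univ x)).differentiableAt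
  induction p using MvPolynomial.induction_on with
  | C a => simp
  | add p q hp hq =>
    simp only [map_add]
    rw [fderiv_fun_add (hdiff p) (hdiff q), add_apply, hp, hq]
  | mul_X p j hp =>
    have hX : HasFDerivAt (fun y : σ → ℝ => y j)
        (ContinuousLinearMap.proj j : (σ → ℝ) →L[ℝ] ℝ) x :=
      (ContinuousLinearMap.proj j : (σ → ℝ) →L[ℝ] ℝ).hasFDerivAt
    simp only [map_mul, MvPolynomial.eval_X]
    rw [((hdiff p).hasFDerivAt.fun_mul hX).fderiv, MvPolynomial.pderiv_mul]
    simp only [add_apply, smul_apply, hp,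
      ContinuousLinearMap.proj_apply, smul_eq_mul, map_add, map_mul, MvPolynomial.eval_X,
      MvPolynomial.pderiv_X]
    by_cases hij : j = i
    · subst hij
      simp
      ring
    · simp [hij]
      ring

theorem IsPolyDeg.pd {m : ℤ} {f : (Fin 2 → ℝ) → ℝ} (hf : IsPolyDeg m f) (i : Fin 2) :
    IsPolyDeg (m - 1) (pd i f) := by
  obtain ⟨p, hp, hdeg⟩ := hf
  obtain rfl : f = fun x => MvPolynomial.eval x p := funext hp
  refine ⟨MvPolynomial.pderiv i p, fun x => p.fderiv_eval_single i x, ?_⟩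
  by_cases h : MvPolynomial.pderiv i p = 0
  · exact Or.inr h
  · have hle := p.totalDegree_pderiv_succ_le i h
    rcases hdeg with hdeg | rfl
    · left; omega
    · simp at h

theorem IsPolyDeg.add {m : ℤ} {f g : (Fin 2 → ℝ) → ℝ} (hf : IsPolyDeg m f)
    (hg : IsPolyDeg m g) : IsPolyDeg m (fun x => f x + g x) := by
  obtain ⟨p, hp, hpd⟩ := hf
  obtain ⟨q, hq, hqd⟩ := hg
  refine ⟨p + q, fun x => by simp [hp, hq], ?_⟩
  rcases hpd with hpd | rfl
  · rcases hqd with hqd | rfl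
    · left
      have := MvPolynomial.totalDegree_add p q
      omega
    · left; simpa using hpd
  · simpa using hqd

theorem IsPolyDeg.const_mul {m : ℤ} {f : (Fin 2 → ℝ) → ℝ} (c : ℝ) (hf : IsPolyDeg m f) :
    IsPolyDeg m (fun x => c * f x) := by
  obtain ⟨p, hp, hpd⟩ := hf
  refine ⟨c • p, fun x => by simp [hp], ?_⟩
  rcases hpd with hpd | rfl
  · left
    have := MvPolynomial.totalDegree_smul_le c p
    omega
  · right; simp

theorem IsPolyDeg.continuous {m : ℤ} {f : (Fin 2 → ℝ) → ℝ} (hf : IsPolyDeg m f) :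
    Continuous f := by
  obtain ⟨p, hp, -⟩ := hf
  obtain rfl : f = fun x => MvPolynomial.eval x p := funext hp
  exact MvPolynomial.continuous_eval p

/-- A polynomial function vanishing on a nonempty open set vanishes everywhere. -/
theorem IsPolyDeg.eq_zero_of_eqOn_open {m : ℤ} {f : (Fin 2 → ℝ) → ℝ} (hf : IsPolyDeg m f)
    {U : Set (Fin 2 → ℝ)} (hU : IsOpen U) (hne : U.Nonempty) (h0 : ∀ x ∈ U, f x = 0)
    (x : Fin 2 → ℝ) : f x = 0 := by
  obtain ⟨p, hp, -⟩ := hf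
  obtain ⟨z, hz⟩ := hne
  have han : AnalyticOnNhd ℝ f Set.univ := by
    obtain rfl : f = fun x => MvPolynomial.eval x p := funext hp
    exact AnalyticOnNhd.eval_mvPolynomial p
  exact han.eqOn_zero_of_preconnected_of_eventuallyEq_zero isPreconnected_univ
    (Set.mem_univ z) (Filter.eventually_of_mem (hU.mem_nhds hz) h0) (Set.mem_univ x)

theorem IsPolyDeg.symGrad {m : ℤ} {v : (Fin 2 → ℝ) → Fin 2 → ℝ}
    (hv : ∀ i, IsPolyDeg m (fun x => v x i)) (i j : Fin 2) :
    IsPolyDeg (m - 1) (fun x => symGrad v x i j) := by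
  have h := (((hv i).pd j).add ((hv j).pd i)).const_mul (1 / 2)
  convert h using 2
  simp [_root_.symGrad]
  ring

theorem symGrad_symm (v : (Fin 2 → ℝ) → Fin 2 → ℝ) (x : Fin 2 → ℝ) :
    symGrad v x 1 0 = symGrad v x 0 1 := by
  simp [symGrad, add_comm]

/-- A continuous function that is nonnegative on a compact set and has zero integral over it
vanishes on every open subset. -/
theorem Continuous.eqOn_open_zero_of_setIntegral_eq_zero {f : (Fin 2 → ℝ) → ℝ}
    (hf : Continuous f) {K U : Set (Fin 2 → ℝ)} (hK : IsCompact K) (hU : IsOpen U) (hUK : U ⊆ K)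
    (h0 : ∀ x ∈ K, 0 ≤ f x) (hint : ∫ x in K, f x = 0) : ∀ x ∈ U, f x = 0 := by
  have hae := (setIntegral_eq_zero_iff_of_nonneg_ae
    ((ae_restrict_iff' hK.measurableSet).2 (Filter.Eventually.of_forall h0))
    (hf.continuousOn.integrableOn_compact hK)).1 hint
  exact Measure.eqOn_open_of_ae_eq (ae_restrict_of_ae_restrict_of_subset hUK hae) hU
    hf.continuousOn continuousOn_const

/-- A symmetric matrix vanishes when its quadratic form vanishes on `n₁⊥`, `n₂⊥` and
`(n₁ + n₂)⊥` for linearly independent `n₁`, `n₂`. -/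
theorem symm_eq_zero_of_frob_vvT_perp {n₁ n₂ n₀ : Fin 2 → ℝ} (hn₀ : ∀ j, n₀ j = -n₁ j - n₂ j)
    (hdet : n₁ 0 * n₂ 1 - n₁ 1 * n₂ 0 ≠ 0) {E : Matrix (Fin 2) (Fin 2) ℝ}
    (hsymm : E 1 0 = E 0 1) (h₁ : frob (vvT (perp n₁)) E = 0) (h₂ : frob (vvT (perp n₂)) E = 0)
    (h₀ : frob (vvT (perp n₀)) E = 0) : E = 0 := by
  simp only [frob, vvT, perp, Fin.sum_univ_two, Matrix.of_apply, Matrix.cons_val_zero,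
    Matrix.cons_val_one, hsymm, hn₀] at h₁ h₂ h₀
  have h₁₂ : n₁ 1 * n₂ 1 * E 0 0 - (n₁ 1 * n₂ 0 + n₁ 0 * n₂ 1) * E 0 1
      + n₁ 0 * n₂ 0 * E 1 1 = 0 := by
    linear_combination (h₀ - h₁ - h₂) / 2
  have h2 := pow_ne_zero 2 hdet
  have e00 : E 0 0 = 0 := (mul_eq_zero.1 (show (n₁ 0 * n₂ 1 - n₁ 1 * n₂ 0) ^ 2 * E 0 0 = 0 by
    linear_combination n₂ 0 ^ 2 * h₁ + n₁ 0 ^ 2 * h₂ - 2 * n₁ 0 * n₂ 0 * h₁₂)).resolve_left h2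
  have e11 : E 1 1 = 0 := (mul_eq_zero.1 (show (n₁ 0 * n₂ 1 - n₁ 1 * n₂ 0) ^ 2 * E 1 1 = 0 by
    linear_combination n₂ 1 ^ 2 * h₁ + n₁ 1 ^ 2 * h₂ - 2 * n₁ 1 * n₂ 1 * h₁₂)).resolve_left h2
  have e01 : E 0 1 = 0 := (mul_eq_zero.1 (show (n₁ 0 * n₂ 1 - n₁ 1 * n₂ 0) ^ 2 * E 0 1 = 0 by
    linear_combination n₂ 0 * n₂ 1 * h₁ + n₁ 0 * n₁ 1 * h₂
      - (n₁ 0 * n₂ 1 + n₁ 1 * n₂ 0) * h₁₂)).resolve_left h2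
  ext i j
  fin_cases i <;> fin_cases j <;> simp [e00, e01, e11, hsymm]

theorem frob_bubbleStress (x0 x1 x2 : Fin 2 → ℝ) (lam p : Fin 3 → (Fin 2 → ℝ) → ℝ)
    (x : Fin 2 → ℝ) (E : Matrix (Fin 2) (Fin 2) ℝ) :
    frob (bubbleStress x0 x1 x2 lam p x) E =
      lam 2 x * lam 0 x * (p 1 x * frob (vvT (perp (nvec x0 x1 x2 1))) E)
      + lam 0 x * lam 1 x * (p 2 x * frob (vvT (perp (nvec x0 x1 x2 2))) E)
      + lam 1 x * lam 2 x * (p 0 x * frob (vvT (perp (nvec x0 x1 x2 0))) E) := by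
  simp only [frob, bubbleStress, Fin.sum_univ_two, Matrix.add_apply, Matrix.smul_apply,
    smul_eq_mul]
  ring

/-- The vectors `n₁`, `n₂` are linearly independent, and barycentric coordinates form a partition
of unity that reproduces every point. -/
theorem barycentric_partition {x0 x1 x2 : Fin 2 → ℝ} {lam : Fin 3 → (Fin 2 → ℝ) → ℝ}
    (hlam_aff : ∀ i, IsAffineFn (lam i))
    (hlam_val : ∀ i j : Fin 3, lam i (![x0, x1, x2] j) = if i = j then 1 else 0) :
    (nvec x0 x1 x2 1 0 * nvec x0 x1 x2 2 1 - nvec x0 x1 x2 1 1 * nvec x0 x1 x2 2 0 ≠ 0) ∧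
    (∀ x, lam 0 x + lam 1 x + lam 2 x = 1) ∧
    ∀ x, lam 0 x • x0 + lam 1 x • x1 + lam 2 x • x2 = x := by
  choose w c hw using hlam_aff
  have hval : ∀ i, lam i x0 = (if i = 0 then 1 else 0) ∧ lam i x1 = (if i = 1 then 1 else 0) ∧
      lam i x2 = (if i = 2 then 1 else 0) := fun i =>
    ⟨hlam_val i 0, hlam_val i 1, hlam_val i 2⟩
  obtain ⟨a0, a1, a2⟩ := hval 0
  obtain ⟨b0, b1, b2⟩ := hval 1
  obtain ⟨c0, c1, c2⟩ := hval 2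
  rw [hw] at a0 a1 a2 b0 b1 b2 c0 c1 c2
  simp at a0 a1 a2 b0 b1 b2 c0 c1 c2
  set W : Matrix (Fin 2) (Fin 2) ℝ := Matrix.of ![w 1, w 2] with hW
  have hWB : W * Bmat x0 x1 x2 = 1 := by
    ext i j
    fin_cases i <;> fin_cases j <;> simp [hW, Bmat, Matrix.mul_apply] <;> linarith
  have hBW : Bmat x0 x1 x2 * W = 1 := mul_eq_one_comm.1 hWB
  have hinv : (Bmat x0 x1 x2)⁻¹ = W := Matrix.inv_eq_left_inv hWB
  have hdet : W.det ≠ 0 := by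
    intro h
    have := congrArg Matrix.det hWB
    simp [h] at this
  have e00 := congrFun (congrFun hBW 0) 0
  have e01 := congrFun (congrFun hBW 0) 1
  have e10 := congrFun (congrFun hBW 1) 0
  have e11 := congrFun (congrFun hBW 1) 1
  simp [hW, Bmat, Matrix.mul_apply] at e00 e01 e10 e11
  have s0 : w 0 0 + w 1 0 + w 2 0 = 0 := by
    linear_combination (a1 - a0 + b1 - b0 + c1 - c0) * w 1 0 + (a2 - a0 + b2 - b0 + c2 - c0) * w 2 0
      - (w 0 0 + w 1 0 + w 2 0) * e00 - (w 0 1 + w 1 1 + w 2 1) * e10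
  have s1 : w 0 1 + w 1 1 + w 2 1 = 0 := by
    linear_combination (a1 - a0 + b1 - b0 + c1 - c0) * w 1 1 + (a2 - a0 + b2 - b0 + c2 - c0) * w 2 1
      - (w 0 0 + w 1 0 + w 2 0) * e01 - (w 0 1 + w 1 1 + w 2 1) * e11
  have hsum : ∀ x, lam 0 x + lam 1 x + lam 2 x = 1 := by
    intro x
    rw [hw, hw, hw]
    linear_combination a0 + b0 + c0 + (x 0 - x0 0) * s0 + (x 1 - x0 1) * s1
  refine ⟨?_, hsum, fun x => ?_⟩
  · rw [Matrix.det_fin_two] at hdet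
    simpa [nvec, hinv] using hdet
  · have h0 : lam 0 x = 1 - lam 1 x - lam 2 x := by linarith [hsum x]
    ext j
    simp only [Pi.add_apply, Pi.smul_apply, smul_eq_mul, h0, hw]
    fin_cases j
    · simp
      linear_combination (x 0 - x0 0) * e00 + (x 1 - x0 1) * e01 + (x1 0 - x0 0) * b0
        + (x2 0 - x0 0) * c0
    · simp
      linear_combination (x 0 - x0 0) * e10 + (x 1 - x0 1) * e11 + (x1 1 - x0 1) * b0
        + (x2 1 - x0 1) * c0

theorem nonneg_of_mem_Ktri {x0 x1 x2 : Fin 2 → ℝ} {f : (Fin 2 → ℝ) → ℝ} (hf : IsAffineFn f)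
    (h0 : 0 ≤ f x0) (h1 : 0 ≤ f x1) (h2 : 0 ≤ f x2) : ∀ x ∈ Ktri x0 x1 x2, 0 ≤ f x := by
  obtain ⟨w, c, hw⟩ := hf
  refine convexHull_min (t := {x | 0 ≤ f x}) ?_ ?_
  · rintro x (rfl | rfl | rfl) <;> assumption
  · intro x hx y hy a b ha hb hab
    simp only [Set.mem_ofPred_eq, hw, Pi.add_apply, Pi.smul_apply, smul_eq_mul] at hx hy ⊢
    have h := add_nonneg (mul_nonneg ha hx) (mul_nonneg hb hy)
    have hb' : b = 1 - a := by linarith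
    subst hb'
    linarith

theorem IsAffineFn.continuous {f : (Fin 2 → ℝ) → ℝ} (hf : IsAffineFn f) : Continuous f := by
  obtain ⟨w, c, hw⟩ := hf
  obtain rfl : f = fun x => w 0 * x 0 + w 1 * x 1 + c := funext hw
  fun_prop

theorem frob_symGrad_isPolyDeg {m : ℤ} {v : (Fin 2 → ℝ) → Fin 2 → ℝ}
    (hv : ∀ i, IsPolyDeg m (fun x => v x i)) (A : Matrix (Fin 2) (Fin 2) ℝ) :
    IsPolyDeg (m - 1) (fun x => frob A (symGrad v x)) := by
  have h := fun i j => (IsPolyDeg.symGrad hv i j).const_mul (A i j)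
  simp only [frob, Fin.sum_univ_two]
  exact ((h 0 0).add (h 0 1)).add ((h 1 0).add (h 1 1))

theorem stmt_7 (k : ℕ) (hk : 2 ≤ k)
    (x0 x1 x2 : Fin 2 → ℝ)
    (hind : AffineIndependent ℝ ![x0, x1, x2])
    (lam : Fin 3 → (Fin 2 → ℝ) → ℝ)
    (hlam_aff : ∀ i, IsAffineFn (lam i))
    (hlam_val : ∀ i j : Fin 3, lam i (![x0, x1, x2] j) = if i = j then 1 else 0)
    (v : (Fin 2 → ℝ) → Fin 2 → ℝ)
    (hv : ∀ i, IsPolyDeg ((k : ℤ) - 1) (fun x => v x i))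
    (horth : ∀ τ, SigmaKb k x0 x1 x2 lam τ →
      ∫ x in Ktri x0 x1 x2, frob (τ x) (symGrad v x) = 0) :
    ∀ x, symGrad v x = 0 := by
  obtain ⟨hdet, hsum, hrep⟩ := barycentric_partition hlam_aff hlam_val
  set s : Fin 3 → (Fin 2 → ℝ) → ℝ :=
    fun i x => frob (vvT (perp (nvec x0 x1 x2 i))) (symGrad v x) with hs
  have hspoly : ∀ i, IsPolyDeg ((k : ℤ) - 1 - 1) (s i) := fun i => frob_symGrad_isPolyDeg hv _
  have hscont := fun i => (hspoly i).continuous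
  have hlcont := fun i => (hlam_aff i).continuous
  set F : (Fin 2 → ℝ) → ℝ := fun x => lam 2 x * lam 0 x * (s 1 x * s 1 x)
    + lam 0 x * lam 1 x * (s 2 x * s 2 x) + lam 1 x * lam 2 x * (s 0 x * s 0 x) with hF
  have hFcont : Continuous F := by fun_prop
  have hint : ∫ x in Ktri x0 x1 x2, F x = 0 := by
    rw [← horth _ ⟨s, fun i => by convert hspoly i using 1; ring, rfl⟩]
    simp only [frob_bubbleStress, hF, hs]
  have hlnonneg : ∀ i, ∀ x ∈ Ktri x0 x1 x2, 0 ≤ lam i x := by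
    have hv : ∀ i j, 0 ≤ lam i (![x0, x1, x2] j) := fun i j => by
      rw [hlam_val]; split_ifs <;> norm_num
    exact fun i => nonneg_of_mem_Ktri (hlam_aff i) (hv i 0) (hv i 1) (hv i 2)
  have hF0 : ∀ x ∈ Ktri x0 x1 x2, 0 ≤ F x := fun x hx => by
    have h0 := hlnonneg 0 x hx
    have h1 := hlnonneg 1 x hx
    have h2 := hlnonneg 2 x hx
    have hsq := fun i => mul_self_nonneg (s i x)
    exact add_nonneg (add_nonneg (mul_nonneg (mul_nonneg h2 h0) (hsq 1))
      (mul_nonneg (mul_nonneg h0 h1) (hsq 2))) (mul_nonneg (mul_nonneg h1 h2) (hsq 0))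
  set U : Set (Fin 2 → ℝ) := {x | 0 < lam 0 x ∧ 0 < lam 1 x ∧ 0 < lam 2 x} with hU
  have hUopen : IsOpen U :=
    (isOpen_lt continuous_const (hlcont 0)).inter
      ((isOpen_lt continuous_const (hlcont 1)).inter (isOpen_lt continuous_const (hlcont 2)))
  have hUK : U ⊆ Ktri x0 x1 x2 := by
    rintro x ⟨h0, h1, h2⟩
    rw [← hrep x]
    have hx0 : x0 ∈ convexHull ℝ {x0, x1, x2} := subset_convexHull ℝ _ (by simp)
    have hx1 : x1 ∈ convexHull ℝ {x0, x1, x2} := subset_convexHull ℝ _ (by simp)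
    have hx2 : x2 ∈ convexHull ℝ {x0, x1, x2} := subset_convexHull ℝ _ (by simp)
    have h := (convex_convexHull ℝ {x0, x1, x2}).sum_mem (t := Finset.univ)
      (w := fun i : Fin 3 => lam i x) (z := ![x0, x1, x2])
      (fun i _ => by fin_cases i; exacts [h0.le, h1.le, h2.le])
      (by rw [Fin.sum_univ_three]; exact hsum x)
      (fun i _ => by fin_cases i; exacts [hx0, hx1, hx2])
    rw [Fin.sum_univ_three] at h
    exact h
  have hUne : U.Nonempty := by
    refine ⟨fun j => (x0 j + x1 j + x2 j) / 3, ?_⟩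
    have hc : ∀ i, lam i (fun j => (x0 j + x1 j + x2 j) / 3) = 1 / 3 := fun i => by
      have e0 := hlam_val i 0
      have e1 := hlam_val i 1
      have e2 := hlam_val i 2
      obtain ⟨w, c, hw⟩ := hlam_aff i
      rw [hw] at e0 e1 e2 ⊢
      simp only [Matrix.cons_val] at e0 e1 e2
      fin_cases i <;> simp at e0 e1 e2 <;> linarith
    simp [hU, hc]
  have hFU := hFcont.eqOn_open_zero_of_setIntegral_eq_zero
    ((Set.toFinite {x0, x1, x2}).isCompact_convexHull ℝ) hUopen hUK hF0 hint
  have hE : ∀ x ∈ U, symGrad v x = 0 := by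
    intro x hx
    have hFx := hFU x hx
    obtain ⟨h0, h1, h2⟩ := hx
    have p1 := mul_nonneg (mul_pos h2 h0).le (mul_self_nonneg (s 1 x))
    have p2 := mul_nonneg (mul_pos h0 h1).le (mul_self_nonneg (s 2 x))
    have p0 := mul_nonneg (mul_pos h1 h2).le (mul_self_nonneg (s 0 x))
    have z : ∀ {a t : ℝ}, 0 < a → a * (t * t) = 0 → t = 0 := fun ha h =>
      mul_self_eq_zero.1 ((mul_eq_zero.1 h).resolve_left ha.ne')
    refine symm_eq_zero_of_frob_vvT_perp (n₀ := nvec x0 x1 x2 0) (fun j => by simp [nvec]) hdet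
      (symGrad_symm v x)
      (z (t := s 1 x) (mul_pos h2 h0) ?_) (z (t := s 2 x) (mul_pos h0 h1) ?_)
      (z (t := s 0 x) (mul_pos h1 h2) ?_) <;> linarith
  intro x
  ext i j
  exact (IsPolyDeg.symGrad hv i j).eq_zero_of_eqOn_open hUopen hUne
    (fun y hy => by rw [hE y hy]; rfl) x
end
end

section
/- Let k ≥ 2 be an integer. For every τ ∈ Σ_{K,b} and every rigid motion r, ∫_K (div τ)(x) · r(x) dx = 0. -/
open MeasureTheory

noncomputable section

/-- On `ℝ²`, polynomial functions are continuously differentiable. -/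
theorem IsPolyDeg.contDiff {m : ℤ} {f : (Fin 2 → ℝ) → ℝ} (hf : IsPolyDeg m f) :
    ContDiff ℝ 1 f := by
  obtain ⟨p, hp, -⟩ := hf
  rw [funext hp]
  clear hp
  induction p using MvPolynomial.induction_on with
  | C a => simpa using contDiff_const
  | add p q hp hq => simpa using hp.add hq
  | mul_X p i hp => simpa using hp.mul (contDiff_apply ℝ ℝ i)

theorem IsAffineFn.contDiff {f : (Fin 2 → ℝ) → ℝ} (hf : IsAffineFn f) :
    ContDiff ℝ 1 f := by
  obtain ⟨w, c, h⟩ := hf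
  rw [funext h]
  fun_prop

/-- The affine map `y ↦ b + y₀ (a - b) + y₁ (c - a)`, sending the reference triangle
`0 ≤ y₁ ≤ y₀ ≤ 1` onto the triangle with vertices `a`, `b`, `c`. -/
def triMap (a b c : Fin 2 → ℝ) (y : Fin 2 → ℝ) : Fin 2 → ℝ :=
  b + y 0 • (a - b) + y 1 • (c - a)

/-- The reference triangle `0 ≤ y₁ ≤ y₀ ≤ 1`. -/
def refTri : Set (Fin 2 → ℝ) := {y | 0 ≤ y 1 ∧ y 1 ≤ y 0 ∧ y 0 ≤ 1}

theorem measurableSet_refTri : MeasurableSet refTri := by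
  have h : IsClosed refTri :=
    (isClosed_le continuous_const (continuous_apply 1)).inter
      ((isClosed_le (continuous_apply 1) (continuous_apply 0)).inter
        (isClosed_le (continuous_apply 0) continuous_const))
  exact h.measurableSet

theorem image_triMap_refTri (a b c : Fin 2 → ℝ) : triMap a b c '' refTri = Ktri a b c := by
  have hz : ∀ z, z ∈ Ktri a b c ↔ ∃ p q s : ℝ, 0 ≤ p ∧ 0 ≤ q ∧ 0 ≤ s ∧ p + q + s = 1 ∧
      p • a + q • b + s • c = z := by
    intro z
    rw [Ktri, convexHull_insert (by simp), convexHull_pair]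
    simp only [convexJoin_singleton_left, Set.mem_iUnion, segment, Set.mem_ofPred_eq,
      exists_prop]
    constructor
    · rintro ⟨_, ⟨q, s, hq, hs, hqs, rfl⟩, u, v, hu, hv, huv, rfl⟩
      exact ⟨u, v * q, v * s, hu, by positivity, by positivity,
        by linear_combination huv + v * hqs, by simp only [smul_add, smul_smul, add_assoc]⟩
    · rintro ⟨p, q, s, hp, hq, hs, h, rfl⟩
      rcases eq_or_lt_of_le (add_nonneg hq hs) with h0 | h0
      · obtain rfl : q = 0 := by linarith
        obtain rfl : s = 0 := by linarith
        exact ⟨b, ⟨1, 0, by simp⟩, p, 0, hp, le_rfl, by linarith, by simp⟩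
      · refine ⟨_, ⟨q / (q + s), s / (q + s), by positivity, by positivity, by field_simp,
          rfl⟩, p, q + s, hp, h0.le, by linarith, ?_⟩
        rw [smul_add, smul_smul, smul_smul, mul_div_cancel₀ _ h0.ne', mul_div_cancel₀ _ h0.ne',
          add_assoc]
  ext z
  rw [hz]
  constructor
  · rintro ⟨y, ⟨h1, h2, h3⟩, rfl⟩
    refine ⟨y 0 - y 1, 1 - y 0, y 1, by linarith, by linarith, h1, by ring, ?_⟩
    simp only [triMap]
    module
  · rintro ⟨p, q, s, hp, hq, hs, h, rfl⟩
    refine ⟨![p + s, s], ⟨?_, ?_, ?_⟩, ?_⟩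
    · simpa
    · simpa
    · simp; linarith
    · obtain rfl : q = 1 - p - s := by linarith
      simp only [triMap, Matrix.cons_val_zero, Matrix.cons_val_one]
      module

theorem IsAffineFn.apply_triMap {f : (Fin 2 → ℝ) → ℝ} (hf : IsAffineFn f)
    (a b c y : Fin 2 → ℝ) :
    f (triMap a b c y) = f b + y 0 * (f a - f b) + y 1 * (f c - f a) := by
  obtain ⟨w, d, h⟩ := hf
  simp only [h, triMap, Pi.add_apply, Pi.smul_apply, Pi.sub_apply, smul_eq_mul]
  ring

/-- The linear part of `triMap`. -/
def triLin (a b c : Fin 2 → ℝ) : (Fin 2 → ℝ) →L[ℝ] (Fin 2 → ℝ) :=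
  (ContinuousLinearMap.proj (R := ℝ) (φ := fun _ : Fin 2 => ℝ) 0).smulRight (a - b) +
    (ContinuousLinearMap.proj (R := ℝ) (φ := fun _ : Fin 2 => ℝ) 1).smulRight (c - a)

theorem hasFDerivAt_triMap (a b c y : Fin 2 → ℝ) :
    HasFDerivAt (triMap a b c) (triLin a b c) y := by
  have : triMap a b c = fun y => b + triLin a b c y := by
    ext y i
    simp [triMap, triLin, add_assoc]
  rw [this]
  exact (triLin a b c).hasFDerivAt.const_add b

theorem isCompact_Ktri (a b c : Fin 2 → ℝ) : IsCompact (Ktri a b c) :=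
  (Set.toFinite {a, b, c}).isCompact_convexHull ℝ

/-- If `α`, `γ` are the barycentric coordinates of `a`, `c` in the triangle `a b c`, then the
derivative of `α γ g` along the edge `c - a` has mean zero. -/
theorem setIntegral_fderiv_bubble {a b c : Fin 2 → ℝ} {α γ g : (Fin 2 → ℝ) → ℝ}
    (hα : IsAffineFn α) (hγ : IsAffineFn γ) (hg : ContDiff ℝ 1 g)
    (hαa : α a = 1) (hαb : α b = 0) (hαc : α c = 0)
    (hγa : γ a = 0) (hγb : γ b = 0) (hγc : γ c = 1) :
    ∫ x in Ktri a b c, fderiv ℝ (fun x => α x * γ x * g x) x (c - a) = 0 := by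
  set F : (Fin 2 → ℝ) → ℝ := fun x => α x * γ x * g x with hFdef
  have hF : ContDiff ℝ 1 F := (hα.contDiff.mul hγ.contDiff).mul hg
  have hα' : ∀ y, α (triMap a b c y) = y 0 - y 1 := fun y => by
    rw [hα.apply_triMap, hαa, hαb, hαc]; ring
  have hγ' : ∀ y, γ (triMap a b c y) = y 1 := fun y => by
    rw [hγ.apply_triMap, hγa, hγb, hγc]; ring
  have hinj : Set.InjOn (triMap a b c) refTri := by
    intro y _ z _ h
    have h1 := congrArg α h
    have h2 := congrArg γ h
    rw [hα', hα'] at h1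
    rw [hγ', hγ'] at h2
    ext i
    fin_cases i
    · change y 0 = z 0
      linarith
    · exact h2
  have hcont : Continuous fun x => fderiv ℝ F x (c - a) :=
    (hF.continuous_fderiv one_ne_zero).clm_apply continuous_const
  have htri : Continuous (triMap a b c) := by unfold triMap; fun_prop
  rw [← image_triMap_refTri, integral_image_eq_integral_abs_det_fderiv_smul _
    measurableSet_refTri (fun y _ => (hasFDerivAt_triMap a b c y).hasFDerivWithinAt) hinj,
    integral_smul]
  refine smul_eq_zero_of_right _ ?_
  have hint : IntegrableOn (fun y => fderiv ℝ F (triMap a b c y) (c - a)) refTri := by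
    have hsub : refTri ⊆ Set.Icc 0 1 := by
      rintro y ⟨h1, h2, h3⟩
      constructor <;> intro i <;> fin_cases i <;> simp <;> linarith
    exact ((hcont.comp htri).continuousOn.integrableOn_compact isCompact_Icc).mono_set hsub
  have hmp := volume_preserving_finTwoArrow ℝ
  rw [← integral_indicator measurableSet_refTri,
    ← hmp.symm.integral_comp (MeasurableEquiv.measurableEmbedding _)]
  have hint' := (hmp.symm.integrable_comp_emb (MeasurableEquiv.measurableEmbedding _)).2
    ((integrable_indicator_iff measurableSet_refTri).2 hint)
  refine (integral_prod _ hint').trans ?_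
  refine integral_eq_zero_of_ae (Filter.Eventually.of_forall fun u => ?_)
  have key : ∀ t : ℝ, HasDerivAt (fun t => F (triMap a b c ![u, t]))
      (fderiv ℝ F (triMap a b c ![u, t]) (c - a)) t := by
    intro t
    have h1 : HasDerivAt (fun t : ℝ => triMap a b c ![u, t]) (c - a) t := by
      simpa [triMap] using
        ((hasDerivAt_id t).smul_const (c - a)).const_add (b + u • (a - b))
    exact ((hF.differentiable one_ne_zero) _).hasFDerivAt.comp_hasDerivAt t h1
  by_cases hu : 0 ≤ u ∧ u ≤ 1
  · have h : ∀ t : ℝ, refTri.indicator (fun y => fderiv ℝ F (triMap a b c y) (c - a))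
        (MeasurableEquiv.finTwoArrow.symm (u, t)) =
        (Set.Icc 0 u).indicator (fun t => fderiv ℝ F (triMap a b c ![u, t]) (c - a)) t := by
      intro t
      refine Set.indicator_eq_indicator ?_ rfl
      simp [refTri, MeasurableEquiv.finTwoArrow, hu.2]
    simp only [Function.comp_apply, h, Pi.zero_apply]
    rw [integral_indicator measurableSet_Icc, integral_Icc_eq_integral_Ioc,
      ← intervalIntegral.integral_of_le hu.1,
      intervalIntegral.integral_eq_sub_of_hasDerivAt (fun t _ => key t)]
    · simp [hFdef, hα', hγ']
    · refine (hcont.comp (htri.comp ?_)).intervalIntegrable _ _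
      fun_prop
  · have h : ∀ t : ℝ, refTri.indicator (fun y => fderiv ℝ F (triMap a b c y) (c - a))
        (MeasurableEquiv.finTwoArrow.symm (u, t)) = 0 := by
      intro t
      refine Set.indicator_of_notMem ?_ _
      rintro ⟨h1, h2, h3⟩
      simp only [MeasurableEquiv.finTwoArrow] at h1 h2 h3
      exact hu ⟨h1.trans h2, h3⟩
    simp only [Function.comp_apply, h, integral_zero, Pi.zero_apply]

/-- The divergence of `f d dᵀ` tested with a rigid motion is a directional derivative. -/
theorem sum_div_rankOne_mul_rigid {f : (Fin 2 → ℝ) → ℝ} (hf : ContDiff ℝ 1 f)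
    (a b c : ℝ) (d x : Fin 2 → ℝ) :
    fderiv ℝ (fun x => f x * (d 0 * (a - b * x 1) + d 1 * (c + b * x 0))) x d =
      (fderiv ℝ f x (Pi.single 0 1) * d 0 + fderiv ℝ f x (Pi.single 1 1) * d 1) *
        (d 0 * (a - b * x 1) + d 1 * (c + b * x 0)) := by
  have hd : d = d 0 • Pi.single 0 1 + d 1 • Pi.single 1 1 := by
    ext i; fin_cases i <;> simp
  have hfd : fderiv ℝ f x d =
      fderiv ℝ f x (Pi.single 0 1) * d 0 + fderiv ℝ f x (Pi.single 1 1) * d 1 := by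
    conv_lhs => rw [hd]
    simp only [map_add, map_smul, smul_eq_mul]
    ring
  have hp : ∀ i : Fin 2, HasFDerivAt (fun x : Fin 2 → ℝ => x i)
      (ContinuousLinearMap.proj (R := ℝ) (φ := fun _ : Fin 2 => ℝ) i) x :=
    fun i => hasFDerivAt_apply i x
  have hr := ((((hp 1).const_mul b).const_sub a).const_mul (d 0)).add
    ((((hp 0).const_mul b).const_add c).const_mul (d 1))
  have h := ((hf.differentiable one_ne_zero) x).hasFDerivAt.mul hr
  rw [← hfd]
  refine (congrArg (fun L => L d) h.fderiv).trans ?_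
  simp
  ring

theorem perp_nvec (x0 x1 x2 : Fin 2 → ℝ) : ∃ s : ℝ,
    perp (nvec x0 x1 x2 1) = s • (x2 - x0) ∧ perp (nvec x0 x1 x2 2) = s • (x0 - x1) ∧
      perp (nvec x0 x1 x2 0) = s • (x1 - x2) := by
  refine ⟨Ring.inverse (Bmat x0 x1 x2).det, ?_, ?_, ?_⟩ <;> ext i <;> fin_cases i <;>
    simp [perp, nvec, Matrix.inv_def, Matrix.adjugate_fin_two, Bmat] <;> ring

theorem stmt_9 (k : ℕ) (hk : 2 ≤ k)
    (x0 x1 x2 : Fin 2 → ℝ)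
    (hind : AffineIndependent ℝ ![x0, x1, x2])
    (lam : Fin 3 → (Fin 2 → ℝ) → ℝ)
    (hlam_aff : ∀ i, IsAffineFn (lam i))
    (hlam_val : ∀ i j : Fin 3, lam i (![x0, x1, x2] j) = if i = j then 1 else 0)
    (τ : (Fin 2 → ℝ) → Matrix (Fin 2) (Fin 2) ℝ)
    (hτ : SigmaKb k x0 x1 x2 lam τ)
    (r : (Fin 2 → ℝ) → Fin 2 → ℝ) (hr : IsRigidMotion r) :
    ∫ x in Ktri x0 x1 x2, ∑ i : Fin 2, matDiv τ x i * r x i = 0 := by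
  obtain ⟨p, hp, rfl⟩ := hτ
  obtain ⟨a, b, c, hr⟩ := hr
  obtain ⟨s, hs1, hs2, hs0⟩ := perp_nvec x0 x1 x2
  have hv0 : ∀ i, lam i x0 = if i = 0 then 1 else 0 := fun i => hlam_val i 0
  have hv1 : ∀ i, lam i x1 = if i = 1 then 1 else 0 := fun i => hlam_val i 1
  have hv2 : ∀ i, lam i x2 = if i = 2 then 1 else 0 := fun i => hlam_val i 2
  have hbub : ∀ i j l, ContDiff ℝ 1 fun x => lam i x * lam j x * p l x := fun i j l =>
    ((hlam_aff i).contDiff.mul (hlam_aff j).contDiff).mul (hp l).contDiff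
  let ρ : (Fin 2 → ℝ) → (Fin 2 → ℝ) → ℝ := fun d x =>
    d 0 * (a - b * x 1) + d 1 * (c + b * x 0)
  have hρ : ∀ d, ContDiff ℝ 1 (ρ d) := fun d => by
    simp only [ρ]
    fun_prop
  let D : Fin 3 → Fin 3 → Fin 3 → (Fin 2 → ℝ) → (Fin 2 → ℝ) → ℝ := fun i j l d x =>
    fderiv ℝ (fun x => lam i x * lam j x * p l x * ρ d x) x d
  have hD : ∀ i j l d, IntegrableOn (D i j l d) (Ktri x0 x1 x2) := fun i j l d =>
    (((((hbub i j l).mul (hρ d)).continuous_fderiv one_ne_zero).clm_apply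
      continuous_const).continuousOn).integrableOn_compact (isCompact_Ktri _ _ _)
  have hdiff : ∀ i j l x, HasFDerivAt (fun x => lam i x * lam j x * p l x)
      (fderiv ℝ (fun x => lam i x * lam j x * p l x) x) x := fun i j l x =>
    ((hbub i j l).differentiable one_ne_zero x).hasFDerivAt
  have hsum : ∀ x, ∑ i : Fin 2, matDiv (bubbleStress x0 x1 x2 lam p) x i * r x i =
      s ^ 2 * (D 2 0 1 (x2 - x0) x + D 0 1 2 (x0 - x1) x + D 1 2 0 (x1 - x2) x) := by
    intro x
    have hpd : ∀ i j m, pd m (fun y => bubbleStress x0 x1 x2 lam p y i j) x =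
        s ^ 2 * (pd m (fun x => lam 2 x * lam 0 x * p 1 x) x * ((x2 - x0) i * (x2 - x0) j)
          + pd m (fun x => lam 0 x * lam 1 x * p 2 x) x * ((x0 - x1) i * (x0 - x1) j)
          + pd m (fun x => lam 1 x * lam 2 x * p 0 x) x * ((x1 - x2) i * (x1 - x2) j)) := by
      intro i j m
      have h := (((hdiff 2 0 1 x).mul_const (vvT (s • (x2 - x0)) i j)).add
        ((hdiff 0 1 2 x).mul_const (vvT (s • (x0 - x1)) i j))).add
        ((hdiff 1 2 0 x).mul_const (vvT (s • (x1 - x2)) i j))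
      simp only [bubbleStress, hs1, hs2, hs0]
      refine (congrArg (fun L => L (Pi.single m 1)) h.fderiv).trans ?_
      simp [pd, vvT]
      ring
    simp only [D, ρ, sum_div_rankOne_mul_rigid (hbub _ _ _), Fin.sum_univ_two, matDiv, hpd, hr]
    simp [pd]
    ring
  have hzero : ∀ i j l : Fin 3, ∀ y z w : Fin 2 → ℝ, Ktri y z w = Ktri x0 x1 x2 →
      lam i y = 0 → lam i z = 0 → lam i w = 1 → lam j y = 1 → lam j z = 0 → lam j w = 0 →
      ∫ x in Ktri x0 x1 x2, D i j l (w - y) x = 0 := by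
    intro i j l y z w hK h1 h2 h3 h4 h5 h6
    have h := setIntegral_fderiv_bubble (hlam_aff j) (hlam_aff i)
      ((hp l).contDiff.mul (hρ (w - y))) h4 h5 h6 h1 h2 h3
    rw [← hK, ← h]
    simp only [D, mul_assoc, mul_left_comm]
  simp only [hsum]
  have hadd : IntegrableOn (fun x => D 2 0 1 (x2 - x0) x + D 0 1 2 (x0 - x1) x)
      (Ktri x0 x1 x2) := (hD _ _ _ _).add (hD _ _ _ _)
  rw [integral_const_mul, integral_add hadd (hD _ _ _ _),
    integral_add (hD _ _ _ _) (hD _ _ _ _),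
    hzero 2 0 1 x0 x1 x2 rfl (by simp [hv0]) (by simp [hv1]) (by simp [hv2]) (by simp [hv0])
      (by simp [hv1]) (by simp [hv2]),
    hzero 0 1 2 x1 x2 x0 (by unfold Ktri; congr 1; ext; simp; tauto) (by simp [hv1])
      (by simp [hv2]) (by simp [hv0]) (by simp [hv1]) (by simp [hv2]) (by simp [hv0]),
    hzero 1 2 0 x2 x0 x1 (by unfold Ktri; congr 1; ext; simp; tauto) (by simp [hv2])
      (by simp [hv0]) (by simp [hv1]) (by simp [hv2]) (by simp [hv0]) (by simp [hv1])]
  simp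
end
end
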